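/- Let n ≥ 1 and let F₀ be an invertible real n×n matrix. Then for every smooth compactly supported vector field ζ : ℝⁿ → ℝⁿ, ∫_{ℝⁿ} |∇ζ(x)|² dx ≤ 2 |F₀^{-1}|² ∫_{ℝⁿ} |sym(F₀ᵀ ∇ζ(x))|² dx. (This is the Korn-type inequality (1.8) for M = D_Q 𝒵₀''(F₀,Q₀), where 𝒵₀''(F,Q) = 2F sym(FᵀQ), with constant γ = |F₀^{-1,T}|².) -/

import Mathlib

open Matrix MeasureTheory

/-- The Jacobian matrix of a vector field `ζ : ℝⁿ → ℝⁿ`: `(jac ζ x) i j = ∂ζ_i/∂x_j (x)`. -/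
noncomputable def jac {n : ℕ} (ζ : (Fin n → ℝ) → (Fin n → ℝ)) (x : Fin n → ℝ) :
    Matrix (Fin n) (Fin n) ℝ :=
  Matrix.of fun i j => fderiv ℝ ζ x (Pi.single j 1) i

/-- The Frobenius inner product `⟨A : B⟩ = tr(Aᵀ B)`. -/
noncomputable def mip {n : ℕ} (A B : Matrix (Fin n) (Fin n) ℝ) : ℝ :=
  (Aᵀ * B).trace


/-- The symmetric part `sym F = (F + Fᵀ)/2`. -/
noncomputable def msym {n : ℕ} (A : Matrix (Fin n) (Fin n) ℝ) : Matrix (Fin n) (Fin n) ℝ :=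
  (2 : ℝ)⁻¹ • (A + Aᵀ)

theorem integral_fderiv_mul_fderiv_comm {E : Type*} [NormedAddCommGroup E] [NormedSpace ℝ E]
    [FiniteDimensional ℝ E] [MeasurableSpace E] [BorelSpace E] (μ : Measure E)
    [μ.IsAddHaarMeasure] {f g : E → ℝ} (hf : ContDiff ℝ 2 f) (hg : ContDiff ℝ 2 g)
    (hfc : HasCompactSupport f) (v w : E) :
    ∫ x, fderiv ℝ f x v * fderiv ℝ g x w ∂μ = ∫ x, fderiv ℝ f x w * fderiv ℝ g x v ∂μ := by
  have hdg (u : E) : ContDiff ℝ 1 fun x => fderiv ℝ g x u :=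
    (hg.fderiv_right (m := 1) (by norm_num)).clm_apply contDiff_const
  have hdf (u : E) : Continuous fun x => fderiv ℝ f x u :=
    (hf.continuous_fderiv (by norm_num)).clm_apply continuous_const
  have hdfc (u : E) : HasCompactSupport fun x => fderiv ℝ f x u := hfc.fderiv_apply ℝ u
  have key (u u' : E) : ∫ x, f x * fderiv ℝ (fun y => fderiv ℝ g y u') x u ∂μ =
      -∫ x, fderiv ℝ f x u * fderiv ℝ g x u' ∂μ := by
    refine integral_mul_fderiv_eq_neg_fderiv_mul_of_integrable
      (g := fun y => fderiv ℝ g y u') ?_ ?_ ?_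
      (fun x _ => hf.differentiable (by norm_num) x)
      (fun x _ => (hdg u').differentiable (by norm_num) x)
    · exact ((hdf u).mul (hdg u').continuous).integrable_of_hasCompactSupport (hdfc u).mul_right
    · exact (hf.continuous.mul (((hdg u').continuous_fderiv (by norm_num)).clm_apply
        continuous_const)).integrable_of_hasCompactSupport hfc.mul_right
    · exact (hf.continuous.mul (hdg u').continuous).integrable_of_hasCompactSupport hfc.mul_right
  have second (x u u' : E) :
      fderiv ℝ (fun y => fderiv ℝ g y u') x u = fderiv ℝ (fderiv ℝ g) x u u' := by
    have h : DifferentiableAt ℝ (fderiv ℝ g) x :=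
      (hg.fderiv_right (m := 1) (by norm_num)).differentiable (by norm_num) x
    rw [fderiv_clm_apply h (differentiableAt_const u')]
    simp
  have symm (x : E) : fderiv ℝ (fderiv ℝ g) x v w = fderiv ℝ (fderiv ℝ g) x w v :=
    (hg.contDiffAt.isSymmSndFDerivAt (by simp)).eq v w
  rw [← neg_inj, ← key v w, ← key w v]
  simp only [second, symm]

theorem mip_eq_sum {n : ℕ} (A B : Matrix (Fin n) (Fin n) ℝ) :
    mip A B = ∑ i, ∑ j, A i j * B i j := by
  rw [Finset.sum_comm]
  simp [mip, Matrix.trace, Matrix.mul_apply]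

theorem mip_self_nonneg {n : ℕ} (A : Matrix (Fin n) (Fin n) ℝ) : 0 ≤ mip A A := by
  rw [mip_eq_sum]
  exact Finset.sum_nonneg fun i _ => Finset.sum_nonneg fun j _ => mul_self_nonneg _

theorem mip_transpose {n : ℕ} (A B : Matrix (Fin n) (Fin n) ℝ) : mip Aᵀ Bᵀ = mip A B := by
  rw [mip_eq_sum, mip_eq_sum, Finset.sum_comm]
  rfl

attribute [local instance] Matrix.frobeniusNormedRing in
theorem mip_mul_self_le {n : ℕ} (A B : Matrix (Fin n) (Fin n) ℝ) :
    mip (A * B) (A * B) ≤ mip A A * mip B B := by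
  have h (C : Matrix (Fin n) (Fin n) ℝ) : mip C C = ‖C‖ ^ 2 := by
    rw [mip_eq_sum, Matrix.frobenius_norm_def, ← Real.sqrt_eq_rpow, Real.sq_sqrt (by positivity)]
    simp [sq]
  rw [h, h, h, ← mul_pow]
  gcongr
  exact Matrix.frobenius_norm_mul A B

theorem two_mul_mip_msym_self {n : ℕ} (A : Matrix (Fin n) (Fin n) ℝ) :
    2 * mip (msym A) (msym A) = mip A A + mip Aᵀ A := by
  have h : mip Aᵀ Aᵀ = mip A A := mip_transpose A A
  have h' : mip A Aᵀ = mip Aᵀ A := mip_transpose Aᵀ A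
  have e : mip (msym A) (msym A) =
      4⁻¹ * (mip A A + mip A Aᵀ + mip Aᵀ A + mip Aᵀ Aᵀ) := by
    simp only [mip_eq_sum, ← Finset.sum_add_distrib, Finset.mul_sum]
    refine Finset.sum_congr rfl fun i _ => Finset.sum_congr rfl fun j _ => ?_
    simp [msym]
    ring
  rw [e, h, h']
  ring

theorem jac_mulVec {n : ℕ} (A : Matrix (Fin n) (Fin n) ℝ) {ζ : (Fin n → ℝ) → (Fin n → ℝ)}
    {x : Fin n → ℝ} (hζ : DifferentiableAt ℝ ζ x) :
    jac (fun y => A *ᵥ ζ y) x = A * jac ζ x := by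
  ext i j
  have h : HasFDerivAt (fun y => A *ᵥ ζ y)
      ((LinearMap.toContinuousLinearMap (Matrix.mulVecLin A)).comp (fderiv ℝ ζ x)) x :=
    (LinearMap.toContinuousLinearMap (Matrix.mulVecLin A)).hasFDerivAt.comp x hζ.hasFDerivAt
  simp [jac, h.fderiv, Matrix.mul_apply, Matrix.mulVec, dotProduct]

section VectorField

variable {n : ℕ} {η : (Fin n → ℝ) → (Fin n → ℝ)}

theorem jac_apply {x : Fin n → ℝ} (hη : DifferentiableAt ℝ η x) (i j : Fin n) :
    jac η x i j = fderiv ℝ (fun y => η y i) x (Pi.single j 1) := by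
  simp [jac, fderiv_apply hη]

theorem continuous_jac_apply (hη : ContDiff ℝ 1 η) (i j : Fin n) :
    Continuous fun x => jac η x i j := by
  have h : Continuous fun x => fderiv ℝ η x (Pi.single j 1) :=
    (hη.continuous_fderiv (by norm_num)).clm_apply continuous_const
  exact (continuous_apply i).comp h

theorem hasCompactSupport_jac_apply (hηc : HasCompactSupport η) (i j : Fin n) :
    HasCompactSupport fun x => jac η x i j :=
  (hηc.fderiv_apply ℝ (Pi.single j 1)).comp_left (g := fun v : Fin n → ℝ => v i) rfl

theorem integrable_jac_mul_jac (hη : ContDiff ℝ 1 η) (hηc : HasCompactSupport η)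
    (i j k l : Fin n) : Integrable fun x => jac η x i j * jac η x k l :=
  ((continuous_jac_apply hη i j).mul
    (continuous_jac_apply hη k l)).integrable_of_hasCompactSupport
      (hasCompactSupport_jac_apply hηc i j).mul_right

theorem integrable_mip_jac (hη : ContDiff ℝ 1 η) (hηc : HasCompactSupport η) :
    Integrable fun x => mip (jac η x) (jac η x) := by
  simp only [mip_eq_sum]
  exact integrable_finsetSum _ fun i _ => integrable_finsetSum _ fun j _ =>
    integrable_jac_mul_jac hη hηc i j i j

theorem integrable_mip_transpose_jac (hη : ContDiff ℝ 1 η) (hηc : HasCompactSupport η) :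
    Integrable fun x => mip (jac η x)ᵀ (jac η x) := by
  simp only [mip_eq_sum]
  exact integrable_finsetSum _ fun i _ => integrable_finsetSum _ fun j _ =>
    integrable_jac_mul_jac hη hηc j i i j

theorem integral_mip_transpose_jac (hη : ContDiff ℝ 2 η) (hηc : HasCompactSupport η) :
    ∫ x, mip (jac η x)ᵀ (jac η x) = ∫ x, (jac η x).trace ^ 2 := by
  have hη1 : ContDiff ℝ 1 η := hη.of_le (by norm_num)
  have hd : Differentiable ℝ η := hη.differentiable (by norm_num)
  have hi := integrable_jac_mul_jac hη1 hηc
  have swap (i j : Fin n) :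
      ∫ x, jac η x j i * jac η x i j = ∫ x, jac η x j j * jac η x i i := by
    simp only [jac_apply (hd _)]
    exact integral_fderiv_mul_fderiv_comm volume (contDiff_pi.1 hη j) (contDiff_pi.1 hη i)
      (hηc.comp_left (g := fun v : Fin n → ℝ => v j) rfl) _ _
  simp only [mip_eq_sum, Matrix.transpose_apply, Matrix.trace, Matrix.diag_apply, sq,
    Finset.sum_mul_sum]
  rw [integral_finsetSum _ fun i _ => integrable_finsetSum _ fun j _ => hi j i i j,
    integral_finsetSum _ fun i _ => integrable_finsetSum _ fun j _ => hi i i j j]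
  refine Finset.sum_congr rfl fun i _ => ?_
  rw [integral_finsetSum _ fun j _ => hi j i i j, integral_finsetSum _ fun j _ => hi i i j j]
  refine Finset.sum_congr rfl fun j _ => ?_
  rw [swap]
  simp only [mul_comm]

/-- Korn's first inequality for compactly supported vector fields. -/
theorem integral_mip_jac_le_two_mul_integral_mip_msym (hη : ContDiff ℝ 2 η)
    (hηc : HasCompactSupport η) :
    ∫ x, mip (jac η x) (jac η x) ≤ 2 * ∫ x, mip (msym (jac η x)) (msym (jac η x)) := by
  have hη1 : ContDiff ℝ 1 η := hη.of_le (by norm_num)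
  rw [← integral_const_mul]
  simp only [two_mul_mip_msym_self]
  rw [integral_add (integrable_mip_jac hη1 hηc) (integrable_mip_transpose_jac hη1 hηc),
    integral_mip_transpose_jac hη hηc]
  exact le_add_of_nonneg_right (integral_nonneg fun x => sq_nonneg _)

end VectorField

theorem stmt_4 {n : ℕ} (hn : 1 ≤ n)
    (F₀ : Matrix (Fin n) (Fin n) ℝ) (hF₀ : IsUnit F₀.det)
    (ζ : (Fin n → ℝ) → (Fin n → ℝ)) (hζ : ContDiff ℝ (⊤ : ℕ∞) ζ)
    (hζc : HasCompactSupport ζ) :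
    ∫ x, mip (jac ζ x) (jac ζ x)
      ≤ 2 * mip F₀⁻¹ F₀⁻¹ *
        ∫ x, mip (msym (F₀ᵀ * jac ζ x)) (msym (F₀ᵀ * jac ζ x)) := by
  have hζ2 : ContDiff ℝ 2 ζ := contDiff_infty.1 hζ 2
  have hd : Differentiable ℝ ζ := hζ2.differentiable (by norm_num)
  set η : (Fin n → ℝ) → (Fin n → ℝ) := fun y => F₀ᵀ *ᵥ ζ y
  have hη : ContDiff ℝ 2 η :=
    (LinearMap.toContinuousLinearMap (Matrix.mulVecLin F₀ᵀ)).contDiff.comp hζ2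
  have hηc : HasCompactSupport η :=
    hζc.comp_left (g := fun v : Fin n → ℝ => F₀ᵀ *ᵥ v) (Matrix.mulVec_zero _)
  have hjac (x : Fin n → ℝ) : F₀ᵀ * jac ζ x = jac η x := (jac_mulVec F₀ᵀ (hd x)).symm
  have pointwise (x : Fin n → ℝ) :
      mip (jac ζ x) (jac ζ x) ≤ mip F₀⁻¹ F₀⁻¹ * mip (jac η x) (jac η x) := by
    have h : jac ζ x = (F₀⁻¹)ᵀ * jac η x := by
      rw [← hjac, ← Matrix.mul_assoc, ← Matrix.transpose_mul, Matrix.mul_nonsing_inv _ hF₀,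
        Matrix.transpose_one, Matrix.one_mul]
    calc mip (jac ζ x) (jac ζ x) = mip ((F₀⁻¹)ᵀ * jac η x) ((F₀⁻¹)ᵀ * jac η x) := by rw [← h]
      _ ≤ mip (F₀⁻¹)ᵀ (F₀⁻¹)ᵀ * mip (jac η x) (jac η x) := mip_mul_self_le _ _
      _ = mip F₀⁻¹ F₀⁻¹ * mip (jac η x) (jac η x) := by rw [mip_transpose]
  simp only [hjac]
  calc ∫ x, mip (jac ζ x) (jac ζ x)
      ≤ ∫ x, mip F₀⁻¹ F₀⁻¹ * mip (jac η x) (jac η x) :=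
        integral_mono (integrable_mip_jac (hζ2.of_le (by norm_num)) hζc)
          ((integrable_mip_jac (hη.of_le (by norm_num)) hηc).const_mul _) pointwise
    _ = mip F₀⁻¹ F₀⁻¹ * ∫ x, mip (jac η x) (jac η x) := integral_const_mul _ _
    _ ≤ mip F₀⁻¹ F₀⁻¹ * (2 * ∫ x, mip (msym (jac η x)) (msym (jac η x))) :=
        mul_le_mul_of_nonneg_left (integral_mip_jac_le_two_mul_integral_mip_msym hη hηc)
          (mip_self_nonneg _)
    _ = _ := by ring
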